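/- Let L : ℝⁿ × ℝⁿ → ℝ be continuous, convex in its second variable v for each fixed x (L5), and satisfy the quadratic bounds A⁻¹|v|² − B ≤ L(x,v) ≤ A|v|² + B for all (x,v) and some constants A, B > 0 (L7). Then there exists a constant C_L > 0 depending only on A and B (one may take C_L = 8A + 4B) such that for every x, v ∈ ℝⁿ and every ξ in the subdifferential D_v⁻L(x,v), one has |ξ| ≤ C_L(1 + |v|). -/

import Mathlib

open Metric Set MeasureTheory Filter
open scoped Topology NNReal RealInnerProductSpace

noncomputable section

abbrev Euc (n : ℕ) := EuclideanSpace ℝ (Fin n)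

/-- `v` is a viscosity subsolution of `v + H(x, Dv) = 0` in the open set `Ω`. -/
def IsViscositySubsolutionIn {n : ℕ} (Ω : Set (Euc n)) (H : Euc n → Euc n → ℝ)
    (v : Euc n → ℝ) : Prop :=
  ∀ x ∈ Ω, ∀ φ : Euc n → ℝ, ContDiff ℝ 1 φ →
    IsLocalMaxOn (fun y => v y - φ y) Ω x → v x + H x (gradient φ x) ≤ 0

/-- `v` is a viscosity supersolution of `v + H(x, Dv) = 0` on the closure of `Ω`. -/
def IsViscositySupersolutionOn {n : ℕ} (Ω : Set (Euc n)) (H : Euc n → Euc n → ℝ)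
    (v : Euc n → ℝ) : Prop :=
  ∀ x ∈ closure Ω, ∀ φ : Euc n → ℝ, ContDiff ℝ 1 φ →
    IsLocalMinOn (fun y => v y - φ y) (closure Ω) x → 0 ≤ v x + H x (gradient φ x)

/-- `v` is a state-constraint viscosity solution on `Ω`. -/
def IsStateConstraintSolution {n : ℕ} (Ω : Set (Euc n)) (H : Euc n → Euc n → ℝ)
    (v : Euc n → ℝ) : Prop :=
  ContinuousOn v (closure Ω) ∧ IsViscositySubsolutionIn Ω H v ∧
    IsViscositySupersolutionOn Ω H v

/-- The subdifferential of `L` in the velocity variable `v`. -/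
def subdiffV {n : ℕ} (L : Euc n → Euc n → ℝ) (x v : Euc n) : Set (Euc n) :=
  {ξ | ∀ ε > (0:ℝ), ∃ δ > (0:ℝ), ∀ w : Euc n, ‖w - v‖ < δ →
    -ε * ‖w - v‖ ≤ L x w - L x v - @inner ℝ _ _ ξ (w - v)}

/-- Lemma 5.7: linear growth of the subdifferential of a convex Lagrangian with
quadratic growth. -/
theorem subdifferential_linear_growth {n : ℕ}
    (L : Euc n → Euc n → ℝ) (hLcont : Continuous (Function.uncurry L))
    (hL5 : ∀ x : Euc n, ConvexOn ℝ univ (L x))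
    (A B : ℝ) (hA : 0 < A) (hB : 0 < B)
    (hL7 : ∀ x v : Euc n, A⁻¹ * ‖v‖ ^ 2 - B ≤ L x v ∧ L x v ≤ A * ‖v‖ ^ 2 + B) :
    ∃ C > (0:ℝ), C = 8 * A + 4 * B ∧
      ∀ x v ξ : Euc n, ξ ∈ subdiffV L x v → ‖ξ‖ ≤ C * (1 + ‖v‖) := by
  refine ⟨8 * A + 4 * B, by positivity, rfl, ?_⟩
  intro x v ξ hξ
  have hv := norm_nonneg v
  by_cases h0 : ξ = 0
  · subst h0
    rw [norm_zero]
    positivity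
  have hn : 0 < ‖ξ‖ := norm_pos_iff.mpr h0
  obtain ⟨s, hs⟩ : ∃ s : ℝ, s = 1 + ‖v‖ := ⟨_, rfl⟩
  have hs1 : 1 ≤ s := by linarith
  have hs0 : 0 < s := by linarith
  obtain ⟨u, hu⟩ : ∃ u : Euc n, u = (s / ‖ξ‖) • ξ := ⟨_, rfl⟩
  have hun : ‖u‖ = s := by
    rw [hu, norm_smul, Real.norm_eq_abs, abs_of_pos (by positivity)]
    field_simp
  have hin : @inner ℝ _ _ ξ u = s * ‖ξ‖ := by
    rw [hu, real_inner_smul_right, real_inner_self_eq_norm_sq]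
    field_simp
  obtain ⟨δ, hδ, h⟩ := hξ A hA
  obtain ⟨t, ht⟩ : ∃ t : ℝ, t = min 1 (δ / (2 * s)) := ⟨_, rfl⟩
  have ht0 : 0 < t := by rw [ht]; positivity
  have ht1 : t ≤ 1 := by rw [ht]; exact min_le_left _ _
  have htd : t * s < δ := by
    have h2 : t ≤ δ / (2 * s) := by rw [ht]; exact min_le_right _ _
    rw [le_div_iff₀ (by positivity)] at h2
    nlinarith
  have hnt : ‖t • u‖ = t * s := by
    rw [norm_smul, Real.norm_eq_abs, abs_of_pos ht0, hun]
  have h1 := h (v + t • u) (by rw [add_sub_cancel_left, hnt]; exact htd)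
  rw [add_sub_cancel_left, hnt, real_inner_smul_right, hin] at h1
  have h2 := (hL5 x).2 (mem_univ v) (mem_univ (v + u)) (sub_nonneg.mpr ht1) ht0.le
    (by ring)
  have h3 : (1 - t) • v + t • (v + u) = v + t • u := by module
  rw [h3, smul_eq_mul, smul_eq_mul] at h2
  have h4 : s * ‖ξ‖ ≤ L x (v + u) - L x v + A * s := by
    have : t * (s * ‖ξ‖) ≤ t * (L x (v + u) - L x v + A * s) := by linarith
    exact le_of_mul_le_mul_left this ht0
  have h5 := (hL7 x (v + u)).2
  have h6 := (hL7 x v).1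
  have h7 : 0 ≤ A⁻¹ * ‖v‖ ^ 2 := by positivity
  have h8 : ‖v + u‖ ≤ 2 * s := by
    have := norm_add_le v u
    linarith
  have h9 : ‖v + u‖ ^ 2 ≤ (2 * s) ^ 2 := by gcongr
  have h10 : A * ‖v + u‖ ^ 2 ≤ A * (2 * s) ^ 2 := by gcongr
  have h11 : s ≤ s * s := by nlinarith
  have h12 : A * s ≤ A * (s * s) := by gcongr
  have h13 : B ≤ B * (s * s) := by nlinarith
  have h14 : 0 ≤ A * (s * s) := by positivity
  rw [← hs]
  have : s * ‖ξ‖ ≤ s * ((8 * A + 4 * B) * s) := by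
    have : 0 ≤ B * (s * s) := by positivity
    linarith
  exact le_of_mul_le_mul_left this hs0
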